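/- arXiv:1005.2987 — 2 statements merged into one kernel-verified Lean document; each statement's English description precedes it below -/
import Mathlib

section
/- (Rieffel) Let A be a unital complex Banach algebra. The map π₀(GL_n(A)) → π₀(GL_{n+1}(A)) induced by the embedding g ↦ diag(g,1) is surjective for every n ≥ bsr A, and injective for every n ≥ bsr A + 1. -/
/-- The set of unimodular `n`-tuples: tuples `(a₁, …, aₙ)` with `A·a₁ + ⋯ + A·aₙ = A`. -/
def Lg (A : Type*) [Ring A] (n : ℕ) : Set (Fin n → A) :=
  {a | ∃ x : Fin n → A, ∑ i, x i * a i = 1}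

/-- The Bass stable rank: the least `n ≥ 1` such that every unimodular `(n+1)`-tuple is
reducible to a unimodular `n`-tuple. -/
noncomputable def bsr (A : Type*) [Ring A] : ℕ∞ :=
  sInf {c : ℕ∞ | ∃ n : ℕ, c = n ∧ 1 ≤ n ∧
    ∀ a ∈ Lg A (n + 1), ∃ x : Fin n → A,
      (fun i : Fin n => a i.castSucc + x i * a (Fin.last n)) ∈ Lg A n}

/-- The map induced on path components by a continuous map. -/
def pi0Map {X Y : Type*} [TopologicalSpace X] [TopologicalSpace Y] {f : X → Y}
    (hf : Continuous f) : ZerothHomotopy X → ZerothHomotopy Y :=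
  Quotient.map f (fun _ _ h => Nonempty.map (fun p => p.map hf) h)

/-- `GL_n(A)`: the group of invertible `n × n` matrices over `A`, topologized as a
subspace of `M_n(A)`. -/
abbrev GLn (A : Type*) [Ring A] [TopologicalSpace A] (n : ℕ) : Type _ :=
  {M : Matrix (Fin n) (Fin n) A // IsUnit M}

/-- `diag(·, 1)`, as a multiplicative monoid homomorphism `M_n(A) → M_{n+1}(A)`. -/
def diagOneHom (A : Type*) [Ring A] (n : ℕ) :
    Matrix (Fin n) (Fin n) A →* Matrix (Fin (n + 1)) (Fin (n + 1)) A where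
  toFun M := (Matrix.fromBlocks M 0 0 (1 : Matrix (Fin 1) (Fin 1) A)).submatrix
      finSumFinEquiv.symm finSumFinEquiv.symm
  map_one' := by
    show (Matrix.fromBlocks (1 : Matrix (Fin n) (Fin n) A) 0 0
        (1 : Matrix (Fin 1) (Fin 1) A)).submatrix _ _ = 1
    rw [Matrix.fromBlocks_one, Matrix.submatrix_one_equiv]
  map_mul' M N := by
    rw [Matrix.submatrix_mul_equiv _ _ _ finSumFinEquiv.symm _, Matrix.fromBlocks_multiply]
    simp

lemma continuous_diagOneHom (A : Type*) [Ring A] [TopologicalSpace A] (n : ℕ) :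
    Continuous (diagOneHom A n) := by
  apply continuous_pi; intro i; apply continuous_pi; intro j
  show Continuous fun M : Matrix (Fin n) (Fin n) A =>
    Matrix.fromBlocks M 0 0 (1 : Matrix (Fin 1) (Fin 1) A)
      (finSumFinEquiv.symm i) (finSumFinEquiv.symm j)
  rcases finSumFinEquiv.symm i with a | a <;> rcases finSumFinEquiv.symm j with b | b <;> simp <;>
    first
      | exact (continuous_apply b).comp (continuous_apply a)
      | exact continuous_const

/-- The embedding `GL_n(A) → GL_{n+1}(A)`, `g ↦ diag(g, 1)`. -/
def glSucc (A : Type*) [Ring A] [TopologicalSpace A] (n : ℕ) : GLn A n → GLn A (n + 1) :=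
  fun u => ⟨diagOneHom A n u.1, u.2.map (diagOneHom A n)⟩

lemma continuous_glSucc (A : Type*) [Ring A] [TopologicalSpace A] (n : ℕ) :
    Continuous (glSucc A n) :=
  ((continuous_diagOneHom A n).comp continuous_subtype_val).subtype_mk _

lemma glSucc_one (A : Type*) [Ring A] [TopologicalSpace A] (n : ℕ) :
    glSucc A n ⟨1, isUnit_one⟩ = ⟨1, isUnit_one⟩ := by
  simp [glSucc]

set_option linter.unusedSectionVars false
/-! ### Stable range conditions -/

/-- The stable range condition. -/
def SRc (A : Type*) [Ring A] (n : ℕ) : Prop :=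
  ∀ a ∈ Lg A (n + 1), ∃ x : Fin n → A,
      (fun i : Fin n => a i.castSucc + x i * a (Fin.last n)) ∈ Lg A n

/-- The stable range condition in matrix form. -/
def SRM (A : Type*) [Ring A] (ι : Type*) [Fintype ι] : Prop :=
  ∀ (b : Matrix ι (Fin 1) A) (q : Matrix (Fin 1) (Fin 1) A) (X : Matrix (Fin 1) ι A)
    (W : Matrix (Fin 1) (Fin 1) A), X * b + W * q = 1 →
    ∃ (c : Matrix ι (Fin 1) A) (Y : Matrix (Fin 1) ι A), Y * (b + c * q) = 1

lemma SRc.succ {A : Type*} [Ring A] {n : ℕ} (h : SRc A n) : SRc A (n + 1) := by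
  rintro a ⟨x, hx⟩
  rw [Fin.sum_univ_castSucc, Fin.sum_univ_castSucc] at hx
  set p := a (Fin.last n).castSucc with hp
  set q := a (Fin.last (n+1)) with hq
  set s := x (Fin.last n).castSucc with hs
  set r := x (Fin.last (n+1)) with hr
  have h1 : (Fin.snoc (fun i : Fin n => a i.castSucc.castSucc) (s * p + r * q) : Fin (n+1) → A)
      ∈ Lg A (n+1) := by
    refine ⟨Fin.snoc (fun i : Fin n => x i.castSucc.castSucc) 1, ?_⟩
    rw [Fin.sum_univ_castSucc]
    simp only [Fin.snoc_castSucc, Fin.snoc_last, one_mul]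
    rw [← hx, add_assoc]
  obtain ⟨w, y, hy⟩ := h _ h1
  simp only [Fin.snoc_castSucc, Fin.snoc_last] at hy
  refine ⟨Fin.snoc (fun i => w i * r) 0, Fin.snoc y (∑ i, y i * (w i * s)), ?_⟩
  rw [Fin.sum_univ_castSucc]
  simp only [Fin.snoc_castSucc, Fin.snoc_last, zero_mul, add_zero]
  rw [Finset.sum_mul, ← Finset.sum_add_distrib, ← hy]
  refine Finset.sum_congr rfl fun i _ => ?_
  rw [← hp]
  noncomm_ring

lemma SRc.mono {A : Type*} [Ring A] {n m : ℕ} (h : SRc A n) (hm : n ≤ m) : SRc A m := by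
  induction hm with
  | refl => exact h
  | step _ ih => exact ih.succ

lemma exists_SRc_of_bsr_le {A : Type*} [Ring A] {N : ℕ} (h : bsr A ≤ (N : ℕ∞)) :
    ∃ n : ℕ, bsr A = n ∧ 1 ≤ n ∧ SRc A n := by
  have hne : {c : ℕ∞ | ∃ n : ℕ, c = n ∧ 1 ≤ n ∧
    ∀ a ∈ Lg A (n + 1), ∃ x : Fin n → A,
      (fun i : Fin n => a i.castSucc + x i * a (Fin.last n)) ∈ Lg A n}.Nonempty := by
    by_contra hc
    rw [Set.not_nonempty_iff_eq_empty] at hc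
    rw [bsr, hc, sInf_empty] at h
    exact absurd h (by simp)
  exact csInf_mem hne

lemma SRc_of_bsr_le {A : Type*} [Ring A] {N : ℕ} (h : bsr A ≤ (N : ℕ∞)) : SRc A N := by
  obtain ⟨n, hn, _, hs⟩ := exists_SRc_of_bsr_le h
  rw [hn] at h
  exact hs.mono (by exact_mod_cast h)

lemma SRc_of_bsr_succ_le {A : Type*} [Ring A] {N : ℕ} (h : bsr A + 1 ≤ (N : ℕ∞)) :
    ∃ k, N = k + 1 ∧ SRc A k ∧ SRc A N := by
  have h' : bsr A ≤ (N : ℕ∞) := le_trans (by simp) h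
  obtain ⟨n, hn, _, hs⟩ := exists_SRc_of_bsr_le h'
  rw [hn] at h
  have h2 : n + 1 ≤ N := by exact_mod_cast h
  exact ⟨N - 1, by omega, hs.mono (by omega), hs.mono (by omega)⟩

lemma SRc.matrix {A : Type*} [Ring A] {n : ℕ} (h : SRc A n) : SRM A (Fin n) := by
  intro b q X W hX
  obtain ⟨x, y, hy⟩ := h (Fin.snoc (fun i => b i 0) (q 0 0)) ⟨Fin.snoc (fun i => X 0 i) (W 0 0), by
    rw [Fin.sum_univ_castSucc]
    simp only [Fin.snoc_castSucc, Fin.snoc_last]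
    have := congrFun (congrFun hX 0) 0
    simpa [Matrix.mul_apply] using this⟩
  simp only [Fin.snoc_castSucc, Fin.snoc_last] at hy
  refine ⟨Matrix.of fun i _ => x i, Matrix.of fun _ i => y i, ?_⟩
  ext i j
  rw [Subsingleton.elim i 0, Subsingleton.elim j 0]
  simpa [Matrix.mul_apply] using hy

/-! ### Block matrices -/

section blocks
open Matrix

variable {A : Type*} [Ring A] {ι : Type*} [Fintype ι] [DecidableEq ι]

/-- upper unipotent -/
def uMat (c : Matrix ι (Fin 1) A) : Matrix (ι ⊕ Fin 1) (ι ⊕ Fin 1) A := fromBlocks 1 c 0 1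

/-- lower unipotent -/
def lMat (r : Matrix (Fin 1) ι A) : Matrix (ι ⊕ Fin 1) (ι ⊕ Fin 1) A := fromBlocks 1 0 r 1

lemma isUnit_of_inv {R : Type*} [Ring R] {x y : R} (h : x * y = 1) (h' : y * x = 1) : IsUnit x :=
  ⟨⟨x, y, h, h'⟩, rfl⟩

lemma isUnit_uMat (c : Matrix ι (Fin 1) A) : IsUnit (uMat c) := by
  refine isUnit_of_inv (y := uMat (-c)) ?_ ?_ <;>
  simp [uMat, fromBlocks_multiply, ← fromBlocks_one]

lemma isUnit_lMat (c : Matrix (Fin 1) ι A) : IsUnit (lMat c) := by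
  refine isUnit_of_inv (y := lMat (-c)) ?_ ?_ <;>
  simp [lMat, fromBlocks_multiply, ← fromBlocks_one]

lemma isUnit_block {h : Matrix ι ι A} {r : Matrix (Fin 1) ι A}
    (hu : IsUnit (fromBlocks h 0 r (1 : Matrix (Fin 1) (Fin 1) A))) : IsUnit h := by
  obtain ⟨⟨x, y, h1, h2⟩, hx⟩ := hu
  simp only at hx
  rw [hx, ← fromBlocks_toBlocks y, fromBlocks_multiply, ← fromBlocks_one, fromBlocks_inj] at h1 h2
  have h12 : y.toBlocks₁₂ = 0 := by simpa using h2.2.1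
  exact isUnit_of_inv (y := y.toBlocks₁₁) (by simpa using h1.1) (by simpa [h12] using h2.1)

lemma isUnit_diag {h : Matrix ι ι A} (hu : IsUnit h) :
    IsUnit (fromBlocks h 0 0 (1 : Matrix (Fin 1) (Fin 1) A)) := by
  obtain ⟨⟨x, y, h1, h2⟩, rfl⟩ := hu
  refine isUnit_of_inv (y := fromBlocks y 0 0 1) ?_ ?_ <;>
  simp [fromBlocks_multiply, ← fromBlocks_one, h1, h2]

lemma block_eq (h : Matrix ι ι A) (r : Matrix (Fin 1) ι A) :
    fromBlocks h 0 r (1 : Matrix (Fin 1) (Fin 1) A) = fromBlocks h 0 0 1 * lMat r := by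
  simp [lMat, fromBlocks_multiply]

/-- The product of elementary matrices used to reduce the last column. -/
def eMat (b : Matrix ι (Fin 1) A) (q : Matrix (Fin 1) (Fin 1) A) (c : Matrix ι (Fin 1) A)
    (Y : Matrix (Fin 1) ι A) : Matrix (ι ⊕ Fin 1) (ι ⊕ Fin 1) A :=
  uMat (-(b + c * q)) * (lMat ((1 - q) * Y) * uMat c)

lemma isUnit_eMat (b : Matrix ι (Fin 1) A) (q : Matrix (Fin 1) (Fin 1) A) (c : Matrix ι (Fin 1) A)
    (Y : Matrix (Fin 1) ι A) : IsUnit (eMat b q c Y) :=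
  (isUnit_uMat _).mul ((isUnit_lMat _).mul (isUnit_uMat _))

lemma eMat_mul (b : Matrix ι (Fin 1) A) (q : Matrix (Fin 1) (Fin 1) A) (c : Matrix ι (Fin 1) A)
    (Y : Matrix (Fin 1) ι A) (hY : Y * (b + c * q) = 1) :
    eMat b q c Y * fromRows b q = fromRows 0 1 := by
  have h1 : uMat c * fromRows b q = fromRows (b + c * q) q := by
    simp [uMat, fromBlocks_mul_fromRows]
  have h2 : lMat ((1 - q) * Y) * fromRows (b + c * q) q = fromRows (b + c * q) 1 := by
    simp [lMat, fromBlocks_mul_fromRows, Matrix.mul_assoc, hY]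
  have h3 : uMat (-(b + c * q)) * fromRows (b + c * q) (1 : Matrix (Fin 1) (Fin 1) A)
      = fromRows 0 1 := by
    generalize b + c * q = d
    simp [uMat, fromBlocks_mul_fromRows]
  rw [eMat, Matrix.mul_assoc, Matrix.mul_assoc, h1, h2, h3]

/-- The reduced `n × n` block. -/
def hMat (z : Matrix (ι ⊕ Fin 1) (ι ⊕ Fin 1) A) (c : Matrix ι (Fin 1) A)
    (Y : Matrix (Fin 1) ι A) : Matrix ι ι A :=
  (eMat z.toBlocks₁₂ z.toBlocks₂₂ c Y * z).toBlocks₁₁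

lemma eMat_mul_z (z : Matrix (ι ⊕ Fin 1) (ι ⊕ Fin 1) A) (c : Matrix ι (Fin 1) A)
    (Y : Matrix (Fin 1) ι A) (hY : Y * (z.toBlocks₁₂ + c * z.toBlocks₂₂) = 1) :
    ∃ r, eMat z.toBlocks₁₂ z.toBlocks₂₂ c Y * z = fromBlocks (hMat z c Y) 0 r 1 := by
  have h := eMat_mul _ _ _ _ hY
  set E := eMat z.toBlocks₁₂ z.toBlocks₂₂ c Y with hE
  refine ⟨(E * z).toBlocks₂₁, ?_⟩
  have h12 : (E * z).toBlocks₁₂ = 0 := by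
    ext i j
    have := congrFun (congrFun h (Sum.inl i)) j
    simpa [Matrix.mul_apply, toBlocks₁₂, toBlocks₂₂] using this
  have h22 : (E * z).toBlocks₂₂ = 1 := by
    ext i j
    have := congrFun (congrFun h (Sum.inr i)) j
    simpa [Matrix.mul_apply, toBlocks₁₂, toBlocks₂₂] using this
  conv_lhs => rw [← fromBlocks_toBlocks (E * z), h12, h22]
  rfl

lemma isUnit_hMat {z : Matrix (ι ⊕ Fin 1) (ι ⊕ Fin 1) A} (hz : IsUnit z) {c : Matrix ι (Fin 1) A}
    {Y : Matrix (Fin 1) ι A} (hY : Y * (z.toBlocks₁₂ + c * z.toBlocks₂₂) = 1) :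
    IsUnit (hMat z c Y) := by
  obtain ⟨r, hr⟩ := eMat_mul_z z c Y hY
  exact isUnit_block (r := r) (hr ▸ (isUnit_eMat _ _ _ _).mul hz)

lemma hMat_diag (g : Matrix ι ι A) (c : Matrix ι (Fin 1) A) (Y : Matrix (Fin 1) ι A) :
    hMat (fromBlocks g 0 0 1) c Y = g := by
  simp [hMat, eMat, uMat, lMat, fromBlocks_multiply]

lemma SRM.exists_col {z : Matrix (ι ⊕ Fin 1) (ι ⊕ Fin 1) A} (hz : IsUnit z) (hs : SRM A ι) :
    ∃ (c : Matrix ι (Fin 1) A) (Y : Matrix (Fin 1) ι A),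
      Y * (z.toBlocks₁₂ + c * z.toBlocks₂₂) = 1 := by
  obtain ⟨⟨x, y, h1, h2⟩, rfl⟩ := hz
  refine hs _ _ y.toBlocks₂₁ y.toBlocks₂₂ ?_
  rw [← fromBlocks_toBlocks x, ← fromBlocks_toBlocks y, fromBlocks_multiply, ← fromBlocks_one,
    fromBlocks_inj] at h2
  simpa using h2.2.2.2

/-- Columns `c` such that `b + c q` is left invertible. -/
def cSet (b : Matrix ι (Fin 1) A) (q : Matrix (Fin 1) (Fin 1) A) : Set (Matrix ι (Fin 1) A) :=
  {c | ∃ Y : Matrix (Fin 1) ι A, Y * (b + c * q) = 1}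

lemma cSet_last_iff (c' : Matrix ι (Fin 1) A) (d q : Matrix (Fin 1) (Fin 1) A) :
    fromRows c' d ∈ cSet (fromRows (0 : Matrix ι (Fin 1) A) 1) q ↔
      ∃ (X : Matrix (Fin 1) ι A) (W : Matrix (Fin 1) (Fin 1) A),
        X * c' + W * (1 + q * d) = 1 := by
  have key : ∀ (X : Matrix (Fin 1) ι A) (W : Matrix (Fin 1) (Fin 1) A),
      fromCols X W * (fromRows (0 : Matrix ι (Fin 1) A) 1 + fromRows c' d * q) =
        (X * c') * q + W * (1 + d * q) := by
    intro X W
    have : fromRows (0 : Matrix ι (Fin 1) A) 1 + fromRows c' d * q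
      = fromRows (c' * q) (1 + d * q) := by
      rw [fromRows_mul]; ext (i|i) j <;> simp
    rw [this, fromCols_mul_fromRows, Matrix.mul_assoc]
  constructor
  · rintro ⟨Y, hY⟩
    rw [← fromCols_toCols Y, key] at hY
    generalize Y.toCols₁ = X at *
    generalize Y.toCols₂ = W at *
    refine ⟨q * X, 1 - q * (X * c') - q * W * d, ?_⟩
    rw [Matrix.mul_assoc]
    generalize X * c' = P at *
    have : q * P + (1 - q * P - q * W * d) * (1 + q * d) =
      1 + q * d - q * (P * q + W * (1 + d * q)) * d := by noncomm_ring
    rw [this, hY]; simp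
  · rintro ⟨X, W, h⟩
    refine ⟨fromCols (-(d * X)) (1 - d * W * q), ?_⟩
    rw [key, Matrix.neg_mul, Matrix.mul_assoc]
    generalize X * c' = P at *
    obtain rfl := eq_sub_of_add_eq h
    noncomm_ring

end blocks

/-! ### Topology -/

section top
open Matrix Topology

variable {A : Type*} [NormedRing A] [NormedAlgebra ℂ A] {ι : Type*} [Fintype ι] [DecidableEq ι]

/-- The invertible matrices. -/
def uSet (A : Type*) [Ring A] (ι : Type*) [Fintype ι] [DecidableEq ι] : Set (Matrix ι ι A) :=
  {M | IsUnit M}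

lemma joinedIn_uMat_mul (c : Matrix ι (Fin 1) A) {M : Matrix (ι ⊕ Fin 1) (ι ⊕ Fin 1) A}
    (hM : IsUnit M) : JoinedIn (uSet A (ι ⊕ Fin 1)) M (uMat c * M) := by
  refine JoinedIn.ofLine (f := fun t : ℝ => uMat ((t : ℂ) • c) * M) ?_ ?_ ?_ ?_
  · refine Continuous.continuousOn ?_
    unfold uMat
    fun_prop
  · simp [uMat]
  · simp
  · rintro _ ⟨t, -, rfl⟩
    exact (isUnit_uMat _).mul hM

lemma joinedIn_lMat_mul (c : Matrix (Fin 1) ι A) {M : Matrix (ι ⊕ Fin 1) (ι ⊕ Fin 1) A}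
    (hM : IsUnit M) : JoinedIn (uSet A (ι ⊕ Fin 1)) M (lMat c * M) := by
  refine JoinedIn.ofLine (f := fun t : ℝ => lMat ((t : ℂ) • c) * M) ?_ ?_ ?_ ?_
  · refine Continuous.continuousOn ?_
    unfold lMat
    fun_prop
  · simp [lMat]
  · simp
  · rintro _ ⟨t, -, rfl⟩
    exact (isUnit_lMat _).mul hM

lemma joinedIn_mul_lMat (c : Matrix (Fin 1) ι A) {M : Matrix (ι ⊕ Fin 1) (ι ⊕ Fin 1) A}
    (hM : IsUnit M) : JoinedIn (uSet A (ι ⊕ Fin 1)) M (M * lMat c) := by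
  refine JoinedIn.ofLine (f := fun t : ℝ => M * lMat ((t : ℂ) • c)) ?_ ?_ ?_ ?_
  · refine Continuous.continuousOn ?_
    unfold lMat
    fun_prop
  · simp [lMat]
  · simp
  · rintro _ ⟨t, -, rfl⟩
    exact hM.mul (isUnit_lMat _)

lemma joinedIn_hMat {z : Matrix (ι ⊕ Fin 1) (ι ⊕ Fin 1) A} (hz : IsUnit z) {c : Matrix ι (Fin 1) A}
    {Y : Matrix (Fin 1) ι A} (hY : Y * (z.toBlocks₁₂ + c * z.toBlocks₂₂) = 1) :
    JoinedIn (uSet A (ι ⊕ Fin 1)) (fromBlocks (hMat z c Y) 0 0 1) z := by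
  obtain ⟨r, hr⟩ := eMat_mul_z z c Y hY
  have hu := isUnit_hMat hz hY
  have h1 := joinedIn_mul_lMat r (isUnit_diag hu)
  rw [← block_eq, ← hr, eMat, Matrix.mul_assoc, Matrix.mul_assoc] at h1
  refine h1.trans (JoinedIn.symm ?_)
  refine (joinedIn_uMat_mul c hz).trans ?_
  refine (joinedIn_lMat_mul ((1 - z.toBlocks₂₂) * Y) ((isUnit_uMat c).mul hz)).trans ?_
  exact joinedIn_uMat_mul _ ((isUnit_lMat _).mul ((isUnit_uMat c).mul hz))

lemma cSet_joined_e {κ : Type*} [Fintype κ] [DecidableEq κ] (hs : SRM A κ)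
    (q : Matrix (Fin 1) (Fin 1) A) (c : Matrix (κ ⊕ Fin 1) (Fin 1) A)
    (hc : c ∈ cSet (fromRows (0 : Matrix κ (Fin 1) A) 1) q) :
    JoinedIn (cSet (fromRows (0 : Matrix κ (Fin 1) A) 1) q) c 0 := by
  rw [← fromRows_toRows c] at hc ⊢
  generalize c.toRows₁ = c' at *
  generalize c.toRows₂ = d at *
  obtain ⟨X, W, h⟩ := (cSet_last_iff _ _ _).1 hc
  obtain ⟨w, Y, hY⟩ := hs _ _ _ _ h
  have cont : ∀ (f : ℝ → Matrix κ (Fin 1) A) (g : ℝ → Matrix (Fin 1) (Fin 1) A),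
      Continuous f → Continuous g → Continuous fun t => fromRows (f t) (g t) := by
    intro f g hf hg
    refine continuous_matrix ?_
    rintro (i | i) j
    · simpa using hf.matrix_elem i j
    · simpa using hg.matrix_elem i j
  have j1 : JoinedIn (cSet (fromRows (0 : Matrix κ (Fin 1) A) 1) q) (fromRows c' d)
      (fromRows (c' + w * (1 + q * d)) d) := by
    refine JoinedIn.ofLine (f := fun t : ℝ => fromRows (c' + (t : ℂ) • (w * (1 + q * d))) d)
      ?_ ?_ ?_ ?_
    · refine (cont _ _ ?_ ?_).continuousOn <;> fun_prop
    · simp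
    · simp
    · rintro _ ⟨t, -, rfl⟩
      refine (cSet_last_iff _ _ _).2 ⟨X, W - (t : ℂ) • (X * w), ?_⟩
      refine Eq.trans ?_ h
      generalize 1 + q * d = p
      simp only [Matrix.mul_add X, Matrix.sub_mul, Matrix.smul_mul, Matrix.mul_smul,
        Matrix.mul_assoc]
      abel
  have j2 : JoinedIn (cSet (fromRows (0 : Matrix κ (Fin 1) A) 1) q)
      (fromRows (c' + w * (1 + q * d)) d) (fromRows (c' + w * (1 + q * d)) 0) := by
    refine JoinedIn.symm <| JoinedIn.ofLine (f := fun t : ℝ => fromRows (c' + w * (1 + q * d))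
      ((t : ℂ) • d)) ?_ ?_ ?_ ?_
    · refine (cont _ _ ?_ ?_).continuousOn <;> fun_prop
    · simp
    · simp
    · rintro _ ⟨t, -, rfl⟩
      exact (cSet_last_iff _ _ _).2 ⟨Y, 0, by rw [hY]; simp⟩
  have j3 : JoinedIn (cSet (fromRows (0 : Matrix κ (Fin 1) A) 1) q)
      (fromRows (c' + w * (1 + q * d)) (0 : Matrix (Fin 1) (Fin 1) A)) 0 := by
    refine JoinedIn.symm <| JoinedIn.ofLine (f := fun t : ℝ => fromRows
      ((t : ℂ) • (c' + w * (1 + q * d))) (0 : Matrix (Fin 1) (Fin 1) A)) ?_ ?_ ?_ ?_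
    · refine (cont _ _ ?_ ?_).continuousOn <;> fun_prop
    · ext (i | i) j <;> simp
    · simp
    · rintro _ ⟨t, -, rfl⟩
      exact (cSet_last_iff _ _ _).2 ⟨0, 1, by simp⟩
  exact (j1.trans j2).trans j3

lemma cSet_joined_b {κ : Type*} [Fintype κ] [DecidableEq κ] (hs : SRM A κ)
    (b : Matrix (κ ⊕ Fin 1) (Fin 1) A) (Y : Matrix (Fin 1) (κ ⊕ Fin 1) A) (hb : Y * b = 1)
    (q : Matrix (Fin 1) (Fin 1) A) (c : Matrix (κ ⊕ Fin 1) (Fin 1) A)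
    (hc : c ∈ cSet b q) : JoinedIn (cSet b q) c 0 := by
  obtain ⟨E, F, hEF, hFE, hE⟩ : ∃ E F : Matrix (κ ⊕ Fin 1) (κ ⊕ Fin 1) A,
      E * F = 1 ∧ F * E = 1 ∧ E * b = fromRows (0 : Matrix κ (Fin 1) A) 1 := by
    obtain ⟨w, Z, hZ⟩ := hs b.toRows₁ b.toRows₂ Y.toCols₁ Y.toCols₂ (by
      rw [← fromCols_mul_fromRows, fromCols_toCols, fromRows_toRows, hb])
    obtain ⟨⟨E, F, h1, h2⟩, hE⟩ := isUnit_eMat b.toRows₁ b.toRows₂ w Z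
    simp only at hE
    refine ⟨E, F, h1, h2, ?_⟩
    rw [hE, ← eMat_mul _ _ _ _ hZ, fromRows_toRows]
  have h0 := cSet_joined_e hs q
  rw [← hE] at h0
  have hb' : F * (E * b) = b := by
    rw [← Matrix.mul_assoc, hFE, Matrix.one_mul]
  have h1 : E * c ∈ cSet (E * b) q := by
    obtain ⟨Z, hZ⟩ := hc
    refine ⟨Z * F, ?_⟩
    rw [Matrix.mul_assoc E, ← Matrix.mul_add, Matrix.mul_assoc,
      ← Matrix.mul_assoc F, hFE, Matrix.one_mul, hZ]
  have h2 := (h0 _ h1).map (f := fun x => F * x) (by fun_prop)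
  simp only [← Matrix.mul_assoc, hFE, Matrix.one_mul, Matrix.mul_zero] at h2
  refine h2.mono ?_
  rintro _ ⟨x, ⟨Z, hZ⟩, rfl⟩
  refine ⟨Z * E, ?_⟩
  rw [← hZ, Matrix.mul_assoc, Matrix.mul_add, ← Matrix.mul_assoc E, ← Matrix.mul_assoc E F,
    hEF, Matrix.one_mul]

lemma cSet_joined_sum {κ : Type*} [Fintype κ] [DecidableEq κ] (hs : SRM A κ)
    (b : Matrix (κ ⊕ Fin 1) (Fin 1) A)
    (q : Matrix (Fin 1) (Fin 1) A) (c d : Matrix (κ ⊕ Fin 1) (Fin 1) A)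
    (hc : c ∈ cSet b q) (hd : d ∈ cSet b q) : JoinedIn (cSet b q) c d := by
  obtain ⟨Y, hY⟩ := hd
  have h1 : c - d ∈ cSet (b + d * q) q := by
    obtain ⟨Z, hZ⟩ := hc
    refine ⟨Z, ?_⟩
    rw [← hZ, Matrix.sub_mul, add_assoc, add_sub_cancel]
  have h2 := (cSet_joined_b hs _ Y hY q _ h1).map (f := fun x => x + d) (by fun_prop)
  simp only [sub_add_cancel, zero_add] at h2
  refine h2.mono ?_
  rintro _ ⟨x, ⟨Z, hZ⟩, rfl⟩
  refine ⟨Z, ?_⟩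
  rw [← hZ, Matrix.add_mul]
  congr 1
  abel

lemma cSet_joined {κ : Type*} [Fintype κ] [DecidableEq κ] (hs : SRM A κ) (e : ι ≃ κ ⊕ Fin 1)
    (b : Matrix ι (Fin 1) A)
    (q : Matrix (Fin 1) (Fin 1) A) (c d : Matrix ι (Fin 1) A)
    (hc : c ∈ cSet b q) (hd : d ∈ cSet b q) : JoinedIn (cSet b q) c d := by
  have key : ∀ x ∈ cSet b q, x.submatrix e.symm id ∈ cSet (b.submatrix e.symm id) q := by
    rintro x ⟨Y, hY⟩
    refine ⟨Y.submatrix id e.symm, ?_⟩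
    rw [← hY]
    ext i j
    simp [Matrix.mul_apply, ← e.symm.sum_comp]
  have h2 := (cSet_joined_sum hs _ q _ _ (key c hc) (key d hd)).map
    (f := fun x => x.submatrix e id) (by fun_prop)
  simp only [Matrix.submatrix_submatrix, Equiv.symm_comp_self, Function.comp_id,
    Matrix.submatrix_id_id] at h2
  refine h2.mono ?_
  rintro _ ⟨x, ⟨Z, hZ⟩, rfl⟩
  refine ⟨Z.submatrix id e, ?_⟩
  rw [← hZ]
  ext i j
  simp [Matrix.mul_apply, ← e.symm.sum_comp]

end top

section final
open Matrix Topology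

variable {A : Type*} [NormedRing A] [NormedAlgebra ℂ A] {ι : Type*} [Fintype ι] [DecidableEq ι]

lemma const_of_local {Z : Type*} [TopologicalSpace Z] (G : Set Z) (f : ℝ → Z) (hf : ∀ x, f x ∈ G)
    (H : ∀ x, ∃ U, IsOpen U ∧ x ∈ U ∧ ∃ g : ℝ → Z, ContinuousOn g U ∧
      ∀ y ∈ U, JoinedIn G (f y) (g y)) (x y : ℝ) : JoinedIn G (f x) (f y) := by
  let F : ℝ → ZerothHomotopy G := fun x => ZerothHomotopy.mk ⟨f x, hf x⟩
  have hF : ∀ x y, F x = F y ↔ JoinedIn G (f x) (f y) := by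
    intro x y
    rw [joinedIn_iff_joined (hf x) (hf y)]
    exact Quotient.eq
  have hL : IsLocallyConstant F := by
    rw [IsLocallyConstant.iff_eventually_eq]
    intro x
    obtain ⟨U, hU, hx, g, hg, hj⟩ := H x
    obtain ⟨ε, hε, hb⟩ := Metric.isOpen_iff.1 hU x hx
    filter_upwards [Metric.ball_mem_nhds x hε] with y hy
    rw [hF]
    have hp : IsPathConnected (Metric.ball x ε) :=
      (convex_ball x ε).isPathConnected ⟨x, Metric.mem_ball_self hε⟩
    have hp2 := hp.image' (hg.mono hb)
    have := hp2.joinedIn (g y) ⟨y, hy, rfl⟩ (g x) ⟨x, Metric.mem_ball_self hε, rfl⟩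
    have h3 : JoinedIn G (g y) (g x) := this.mono (by
      rintro _ ⟨w, hw, rfl⟩
      exact (hj w (hb hw)).target_mem)
    exact ((hj y (hb hy)).trans h3).trans (hj x hx).symm
  exact (hF x y).1 (hL.apply_eq_of_preconnectedSpace x y)

lemma continuous_toB12 : Continuous fun z : Matrix (ι ⊕ Fin 1) (ι ⊕ Fin 1) A => z.toBlocks₁₂ :=
  continuous_matrix fun _ _ => continuous_id.matrix_elem _ _

lemma continuous_toB22 : Continuous fun z : Matrix (ι ⊕ Fin 1) (ι ⊕ Fin 1) A => z.toBlocks₂₂ :=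
  continuous_matrix fun _ _ => continuous_id.matrix_elem _ _

lemma continuous_toB11 : Continuous fun z : Matrix (ι ⊕ Fin 1) (ι ⊕ Fin 1) A => z.toBlocks₁₁ :=
  continuous_matrix fun _ _ => continuous_id.matrix_elem _ _

lemma continuous_hMat : Continuous fun p : Matrix (ι ⊕ Fin 1) (ι ⊕ Fin 1) A ×
    Matrix ι (Fin 1) A × Matrix (Fin 1) ι A => hMat p.1 p.2.1 p.2.2 := by
  unfold hMat eMat uMat lMat
  refine continuous_toB11.comp ?_
  have h1 : Continuous fun p : Matrix (ι ⊕ Fin 1) (ι ⊕ Fin 1) A ×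
    Matrix ι (Fin 1) A × Matrix (Fin 1) ι A => p.1.toBlocks₁₂ := continuous_toB12.comp continuous_fst
  have h2 : Continuous fun p : Matrix (ι ⊕ Fin 1) (ι ⊕ Fin 1) A ×
    Matrix ι (Fin 1) A × Matrix (Fin 1) ι A => p.1.toBlocks₂₂ := continuous_toB22.comp continuous_fst
  fun_prop

lemma continuousOn_hMat {U : Set ℝ} {f : ℝ → Matrix (ι ⊕ Fin 1) (ι ⊕ Fin 1) A}
    {g : ℝ → Matrix ι (Fin 1) A} {k : ℝ → Matrix (Fin 1) ι A} (hf : ContinuousOn f U)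
    (hg : ContinuousOn g U) (hk : ContinuousOn k U) :
    ContinuousOn (fun t => hMat (f t) (g t) (k t)) U :=
  Continuous.comp_continuousOn (g := fun p : Matrix (ι ⊕ Fin 1) (ι ⊕ Fin 1) A ×
    Matrix ι (Fin 1) A × Matrix (Fin 1) ι A => hMat p.1 p.2.1 p.2.2)
    (f := fun t => (f t, g t, k t)) continuous_hMat (hf.prodMk (hg.prodMk hk))

/-- Left inverses can be chosen continuously locally. -/
lemma local_inverse [CompleteSpace A] (V : ℝ → Matrix ι (Fin 1) A) (hV : Continuous V) (x : ℝ)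
    (Y : Matrix (Fin 1) ι A) (hY : Y * V x = 1) :
    ∃ U, IsOpen U ∧ x ∈ U ∧ ∃ g : ℝ → Matrix (Fin 1) ι A, ContinuousOn g U ∧
      ∀ y ∈ U, g y * V y = 1 := by
  have hs : Continuous fun y => (Y * V y) 0 0 := by
    have : Continuous fun y => Y * V y := by fun_prop
    exact this.matrix_elem _ _
  refine ⟨{y | IsUnit ((Y * V y) 0 0)}, Units.isOpen.preimage hs, by simp [hY],
    fun y => (Matrix.of fun _ _ => Ring.inverse ((Y * V y) 0 0) : Matrix (Fin 1) (Fin 1) A) * Y,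
    ?_, ?_⟩
  · intro y hy
    refine ContinuousAt.continuousWithinAt ?_
    obtain ⟨u, hu⟩ := hy
    have h1 : ContinuousAt (fun y => Ring.inverse ((Y * V y) 0 0)) y := by
      refine ContinuousAt.comp (g := Ring.inverse) ?_ hs.continuousAt
      rw [← hu]
      exact NormedRing.inverse_continuousAt u
    have h2 : Continuous fun a : A => (Matrix.of fun _ _ => a : Matrix (Fin 1) (Fin 1) A) * Y := by
      have : Continuous fun a : A => (Matrix.of fun _ _ => a : Matrix (Fin 1) (Fin 1) A) :=
        continuous_matrix fun _ _ => continuous_id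
      fun_prop
    exact h2.continuousAt.comp h1
  · intro y hy
    rw [Matrix.mul_assoc]
    ext i j
    rw [Subsingleton.elim i 0, Subsingleton.elim j 0]
    rw [Matrix.mul_apply]
    simpa using Ring.inverse_mul_cancel _ hy

lemma hMat_Y {z : Matrix (ι ⊕ Fin 1) (ι ⊕ Fin 1) A} (hz : IsUnit z) {c : Matrix ι (Fin 1) A}
    {Y Y' : Matrix (Fin 1) ι A} (hY : Y * (z.toBlocks₁₂ + c * z.toBlocks₂₂) = 1)
    (hY' : Y' * (z.toBlocks₁₂ + c * z.toBlocks₂₂) = 1) :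
    JoinedIn (uSet A ι) (hMat z c Y) (hMat z c Y') := by
  refine JoinedIn.ofLine (f := fun t : ℝ => hMat z c (Y + (t : ℂ) • (Y' - Y))) ?_ ?_ ?_ ?_
  · refine continuousOn_hMat continuousOn_const continuousOn_const (Continuous.continuousOn ?_)
    fun_prop
  · simp
  · simp
  · rintro _ ⟨t, -, rfl⟩
    refine isUnit_hMat hz ?_
    rw [Matrix.add_mul, Matrix.smul_mul, Matrix.sub_mul, hY, hY']
    simp

lemma hMat_c [CompleteSpace A] {κ : Type*} [Fintype κ] [DecidableEq κ] (hs : SRM A κ)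
    (e : ι ≃ κ ⊕ Fin 1)
    {z : Matrix (ι ⊕ Fin 1) (ι ⊕ Fin 1) A} (hz : IsUnit z) {c c' : Matrix ι (Fin 1) A}
    {Y Y' : Matrix (Fin 1) ι A} (hY : Y * (z.toBlocks₁₂ + c * z.toBlocks₂₂) = 1)
    (hY' : Y' * (z.toBlocks₁₂ + c' * z.toBlocks₂₂) = 1) :
    JoinedIn (uSet A ι) (hMat z c Y) (hMat z c' Y') := by
  obtain ⟨γ, hγ⟩ := cSet_joined hs e z.toBlocks₁₂ z.toBlocks₂₂ c c' ⟨Y, hY⟩ ⟨Y', hY'⟩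
  have hγ' : ∀ t : ℝ, γ.extend t ∈ cSet z.toBlocks₁₂ z.toBlocks₂₂ := by
    intro t
    obtain ⟨s, hs⟩ : γ.extend t ∈ Set.range γ := by
      rw [← Path.extend_range γ]; exact ⟨t, rfl⟩
    rw [← hs]; exact hγ s
  choose W hW using hγ'
  have hc : Continuous fun t => γ.extend t := γ.continuous_extend
  have key := const_of_local (uSet A ι) (fun t => hMat z (γ.extend t) (W t))
    (fun t => isUnit_hMat hz (hW t)) (by
      intro x
      obtain ⟨U, hU, hx, g, hg, hgU⟩ := local_inverse
        (fun t => z.toBlocks₁₂ + γ.extend t * z.toBlocks₂₂) (by fun_prop) x (W x) (hW x)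
      refine ⟨U, hU, hx, fun t => hMat z (γ.extend t) (g t), ?_, ?_⟩
      · exact continuousOn_hMat continuousOn_const hc.continuousOn hg
      · intro y hy
        exact hMat_Y hz (hW y) (hgU y hy)) 0 1
  have h0 := hW 0
  have h1 := hW 1
  rw [Path.extend_zero] at key h0
  rw [Path.extend_one] at key h1
  exact ((hMat_Y hz hY h0).trans key).trans (hMat_Y hz h1 hY')

lemma hMat_z [CompleteSpace A] {κ : Type*} [Fintype κ] [DecidableEq κ] (hs : SRM A κ)
    (hι : SRM A ι) (e : ι ≃ κ ⊕ Fin 1)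
    {z z' : Matrix (ι ⊕ Fin 1) (ι ⊕ Fin 1) A} (hz : JoinedIn (uSet A (ι ⊕ Fin 1)) z z')
    {c c' : Matrix ι (Fin 1) A}
    {Y Y' : Matrix (Fin 1) ι A} (hY : Y * (z.toBlocks₁₂ + c * z.toBlocks₂₂) = 1)
    (hY' : Y' * (z'.toBlocks₁₂ + c' * z'.toBlocks₂₂) = 1) :
    JoinedIn (uSet A ι) (hMat z c Y) (hMat z' c' Y') := by
  have hzu : IsUnit z := hz.source_mem
  have hzu' : IsUnit z' := hz.target_mem
  obtain ⟨γ, hγ⟩ := hz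
  have hγ' : ∀ t : ℝ, IsUnit (γ.extend t) := by
    intro t
    obtain ⟨s, hs⟩ : γ.extend t ∈ Set.range γ := by
      rw [← Path.extend_range γ]; exact ⟨t, rfl⟩
    rw [← hs]; exact hγ s
  choose C W hW using fun t => hι.exists_col (hγ' t)
  have hc : Continuous fun t => γ.extend t := γ.continuous_extend
  have hc1 : Continuous fun t => (γ.extend t).toBlocks₁₂ := continuous_toB12.comp hc
  have hc2 : Continuous fun t => (γ.extend t).toBlocks₂₂ := continuous_toB22.comp hc
  have key := const_of_local (uSet A ι) (fun t => hMat (γ.extend t) (C t) (W t))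
    (fun t => isUnit_hMat (hγ' t) (hW t)) (by
      intro x
      obtain ⟨U, hU, hx, g, hg, hgU⟩ := local_inverse
        (fun t => (γ.extend t).toBlocks₁₂ + C x * (γ.extend t).toBlocks₂₂) (by fun_prop)
        x (W x) (hW x)
      refine ⟨U, hU, hx, fun t => hMat (γ.extend t) (C x) (g t), ?_, ?_⟩
      · exact continuousOn_hMat hc.continuousOn continuousOn_const hg
      · intro y hy
        exact hMat_c hs e (hγ' y) (hW y) (hgU y hy)) 0 1
  have h0 := hW 0
  have h1 := hW 1
  rw [Path.extend_zero] at key h0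
  rw [Path.extend_one] at key h1
  exact ((hMat_c hs e hzu hY h0).trans key).trans (hMat_c hs e hzu' h1 hY')

/-- Injectivity on blocks. -/
lemma block_injective [CompleteSpace A] {κ : Type*} [Fintype κ] [DecidableEq κ] (hs : SRM A κ)
    (hι : SRM A ι) (e : ι ≃ κ ⊕ Fin 1) {g h : Matrix ι ι A}
    (hj : JoinedIn (uSet A (ι ⊕ Fin 1)) (fromBlocks g 0 0 1) (fromBlocks h 0 0 1)) :
    JoinedIn (uSet A ι) g h := by
  obtain ⟨c, Y, hY⟩ := hι.exists_col hj.source_mem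
  obtain ⟨c', Y', hY'⟩ := hι.exists_col hj.target_mem
  have := hMat_z hs hι e hj hY hY'
  rwa [hMat_diag, hMat_diag] at this

lemma isUnit_submatrix {κ : Type*} [Fintype κ] [DecidableEq κ] (e : κ ≃ ι) {M : Matrix ι ι A}
    (h : IsUnit M) : IsUnit (M.submatrix e e) :=
  h.map (Matrix.reindexRingEquiv A e.symm)

lemma joinedIn_submatrix {κ : Type*} [Fintype κ] [DecidableEq κ] (e : κ ≃ ι) {M N : Matrix ι ι A}
    (h : JoinedIn (uSet A ι) M N) : JoinedIn (uSet A κ) (M.submatrix e e) (N.submatrix e e) := by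
  have := h.map (f := fun x => x.submatrix e e) (by fun_prop)
  refine this.mono ?_
  rintro _ ⟨x, hx, rfl⟩
  exact isUnit_submatrix e hx

end final

/-- (Rieffel) For a unital complex Banach algebra `A`, the map
`π₀(GL_n(A)) → π₀(GL_{n+1}(A))` induced by `g ↦ diag(g, 1)` is surjective for every
`n ≥ bsr A` and injective for every `n ≥ bsr A + 1`. -/
theorem rieffel_pi0_stabilization (A : Type*)
    [NormedRing A] [NormedAlgebra ℂ A] [CompleteSpace A] :
    ∀ n : ℕ,
      (bsr A ≤ (n : ℕ∞) → Function.Surjective (pi0Map (continuous_glSucc A n))) ∧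
      (bsr A + 1 ≤ (n : ℕ∞) → Function.Injective (pi0Map (continuous_glSucc A n))) := by
  intro n
  constructor
  · intro hb x
    have hs : SRM A (Fin n) := (SRc_of_bsr_le hb).matrix
    induction x using Quotient.inductionOn with | _ x
    obtain ⟨x, hx⟩ := x
    have hz : IsUnit (x.submatrix finSumFinEquiv finSumFinEquiv :
      Matrix (Fin n ⊕ Fin 1) (Fin n ⊕ Fin 1) A) := isUnit_submatrix finSumFinEquiv hx
    obtain ⟨c, Y, hY⟩ := hs.exists_col hz
    refine ⟨ZerothHomotopy.mk ⟨_, isUnit_hMat hz hY⟩, ?_⟩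
    refine Quotient.sound ?_
    have h1 := joinedIn_submatrix (finSumFinEquiv (m := n) (n := 1)).symm (joinedIn_hMat hz hY)
    simp only [Matrix.submatrix_submatrix, Equiv.self_comp_symm, Matrix.submatrix_id_id] at h1
    exact h1.joined_subtype
  · intro hb x y hxy
    obtain ⟨k, rfl, hk, hk1⟩ := SRc_of_bsr_succ_le hb
    induction x using Quotient.inductionOn with | _ x
    induction y using Quotient.inductionOn with | _ y
    have h0 : Joined (glSucc A (k + 1) x) (glSucc A (k + 1) y) := Quotient.exact hxy
    have h1 : JoinedIn (uSet A (Fin (k + 1 + 1))) (glSucc A (k + 1) x).1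
      (glSucc A (k + 1) y).1 := (joinedIn_iff_joined (F := uSet A (Fin (k + 1 + 1)))
        (glSucc A (k + 1) x).2 (glSucc A (k + 1) y).2).2 h0
    have h2 := joinedIn_submatrix (finSumFinEquiv (m := k + 1) (n := 1)) h1
    simp only [glSucc, diagOneHom, MonoidHom.coe_mk, OneHom.coe_mk, Matrix.submatrix_submatrix,
      Equiv.symm_comp_self, Matrix.submatrix_id_id] at h2
    have h3 := block_injective hk.matrix hk1.matrix (finSumFinEquiv (m := k) (n := 1)).symm h2
    exact Quotient.sound h3.joined_subtype
end

section
/- Let A be a unital complex Banach algebra, let k ≥ 0, and let A(S^k) denote the Banach algebra C(S^k, A) of continuous maps from the k-sphere to A with the supremum norm and pointwise operations. The map π_k(GL_n(A)) → π_k(GL_{n+1}(A)) induced by the embedding g ↦ diag(g,1) is surjective for every n ≥ csr A(S^k) − 1, and injective for every n ≥ csr A(S^{k+1}) − 1. -/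
/-- The connected stable rank: the least `n ≥ 1` such that `Lg_m(A)` is connected
for all `m ≥ n`. -/
noncomputable def csr (A : Type*) [Ring A] [TopologicalSpace A] : ℕ∞ :=
  sInf {c : ℕ∞ | ∃ n : ℕ, c = n ∧ 1 ≤ n ∧ ∀ m : ℕ, n ≤ m → IsConnected (Lg A m)}

/-- The map induced on homotopy groups by a continuous pointed map. -/
noncomputable def piMap (N : Type*) {X Y : Type*} [TopologicalSpace X] [TopologicalSpace Y]
    (f : C(X, Y)) {x : X} {y : Y} (hf : f x = y) :
    HomotopyGroup N X x → HomotopyGroup N Y y :=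
  Quotient.map
    (fun p => ⟨f.comp p.1, fun t ht => by
      rw [ContinuousMap.comp_apply, p.2 t ht, hf]⟩)
    (fun p q h => h.map (fun H => H.compContinuousMap f))

section Helpers
open Topology unitInterval Filter Set

section collapse
set_option linter.unusedSectionVars false
variable {Y X : Type*} [TopologicalSpace Y] [TopologicalSpace X]

open Classical in
noncomputable def collapseFun (ψ : Y → X) (x : X) : OnePoint Y :=
  if h : ∃ y, ψ y = x then (h.choose : OnePoint Y) else OnePoint.infty

lemma collapseFun_apply {ψ : Y → X} (hψ : Function.Injective ψ) (y : Y) :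
    collapseFun ψ (ψ y) = y := by
  have h : ∃ y', ψ y' = ψ y := ⟨y, rfl⟩
  simp only [collapseFun, dif_pos h]
  rw [hψ h.choose_spec]

lemma collapseFun_of_notMem {ψ : Y → X} {x : X} (hx : x ∉ range ψ) :
    collapseFun ψ x = OnePoint.infty := by
  simp only [collapseFun]
  rw [dif_neg]
  exact hx

lemma continuous_collapseFun [T2Space X] {ψ : Y → X} (hψ : IsOpenEmbedding ψ) :
    Continuous (collapseFun ψ) := by
  rw [continuous_def]
  intro s hs
  by_cases h : OnePoint.infty ∈ s
  · obtain ⟨hc, -⟩ := (OnePoint.isOpen_iff_of_mem' h).1 hs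
    have : collapseFun ψ ⁻¹' s = (ψ '' ((↑) ⁻¹' s : Set Y)ᶜ)ᶜ := by
      ext x
      by_cases hx : x ∈ range ψ
      · obtain ⟨y, rfl⟩ := hx
        simp [collapseFun_apply hψ.injective, hψ.injective.eq_iff]
      · simp only [mem_preimage, collapseFun_of_notMem hx, h, true_iff]
        rintro ⟨y, -, rfl⟩
        exact hx ⟨y, rfl⟩
    rw [this]
    exact (hc.image hψ.continuous).isClosed.isOpen_compl
  · have ho := (OnePoint.isOpen_iff_of_notMem h).1 hs
    have : collapseFun ψ ⁻¹' s = ψ '' ((↑) ⁻¹' s : Set Y) := by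
      ext x
      by_cases hx : x ∈ range ψ
      · obtain ⟨y, rfl⟩ := hx
        simp [collapseFun_apply hψ.injective, hψ.injective.eq_iff]
      · simp only [mem_preimage, collapseFun_of_notMem hx, h, false_iff]
        rintro ⟨y, -, rfl⟩
        exact hx ⟨y, rfl⟩
    rw [this]
    exact hψ.isOpenMap _ ho

lemma exists_lift_collapse [CompactSpace X] {Z : Type*} [TopologicalSpace Z]
    {ψ : Y → X} (hψ : IsOpenEmbedding ψ) (f : C(X, Z)) (z : Z)
    (hf : ∀ x, x ∉ range ψ → f x = z) :
    ∃ F : C(OnePoint Y, Z), F OnePoint.infty = z ∧ ∀ x, F (collapseFun ψ x) = f x := by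
  refine ⟨OnePoint.continuousMapMk (f.comp ⟨ψ, hψ.continuous⟩) z ?_, rfl, fun x => ?_⟩
  · rw [tendsto_nhds]
    intro V hV hz
    rw [hasBasis_coclosedCompact.mem_iff]
    have hcl : IsClosed (f ⁻¹' Vᶜ) := hV.isClosed_compl.preimage f.continuous
    refine ⟨ψ ⁻¹' (f ⁻¹' Vᶜ), ⟨hcl.preimage hψ.continuous, ?_⟩, ?_⟩
    · refine hψ.isInducing.isCompact_preimage_iff ?_ |>.2 hcl.isCompact
      intro x hx
      by_contra h
      apply hx
      rw [hf x h]
      exact hz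
    · intro y hy
      simpa using hy
  · by_cases hx : x ∈ range ψ
    · obtain ⟨y, rfl⟩ := hx
      rw [collapseFun_apply hψ.injective]
      rfl
    · rw [collapseFun_of_notMem hx, hf x hx]
      rfl
end collapse

noncomputable def cubeEmb (k : ℕ) : (Fin k → ℝ) → (Fin k → I) := Pi.map fun _ => unitInterval.sigmoid

lemma range_cubeEmb (k : ℕ) : range (cubeEmb k) = (Cube.boundary (Fin k))ᶜ := by
  unfold cubeEmb
  rw [Set.range_piMap]
  ext y
  simp only [unitInterval.range_sigmoid, Cube.boundary, Set.mem_pi, mem_univ, true_imp_iff, mem_compl_iff,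
    mem_ofPred_eq, not_exists, not_or, mem_Ioo]
  refine forall_congr' fun i => ?_
  rw [unitInterval.pos_iff_ne_zero, unitInterval.lt_one_iff_ne_one]

lemma isOpenEmbedding_cubeEmb (k : ℕ) : IsOpenEmbedding (cubeEmb k) := by
  refine ⟨IsEmbedding.piMap fun _ => isEmbedding_sigmoid, ?_⟩
  unfold cubeEmb
  rw [Set.range_piMap]
  refine isOpen_set_pi finite_univ fun i _ => ?_
  rw [unitInterval.range_sigmoid]
  exact isOpen_Ioo

/-- The collapse of the cube boundary onto a point of the sphere. -/
lemma exists_collapse_sphere (k : ℕ) :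
    ∃ (q : C(Fin k → I, Metric.sphere (0 : EuclideanSpace ℝ (Fin (k + 1))) 1))
      (p : Metric.sphere (0 : EuclideanSpace ℝ (Fin (k + 1))) 1),
      (∀ y ∈ Cube.boundary (Fin k), q y = p) ∧
      ∀ (Z : Type*) [TopologicalSpace Z] (f : C(Fin k → I, Z)) (z : Z),
        (∀ y ∈ Cube.boundary (Fin k), f y = z) →
        ∃ F : C(Metric.sphere (0 : EuclideanSpace ℝ (Fin (k + 1))) 1, Z), F p = z ∧
          ∀ y, F (q y) = f y := by
  let e : OnePoint (Fin k → ℝ) ≃ₜ Metric.sphere (0 : EuclideanSpace ℝ (Fin (k + 1))) 1 :=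
    onePointEquivSphereOfFinrankEq (by simp)
  have hψ := isOpenEmbedding_cubeEmb k
  refine ⟨⟨fun y => e (collapseFun (cubeEmb k) y),
    e.continuous.comp (continuous_collapseFun hψ)⟩, e OnePoint.infty, fun y hy => ?_,
    fun Z _ f z hf => ?_⟩
  · show e _ = _
    rw [collapseFun_of_notMem]
    rw [range_cubeEmb]
    simpa using hy
  · obtain ⟨F, h1, h2⟩ := exists_lift_collapse hψ f z (fun x hx => hf x (by
      rw [range_cubeEmb] at hx; simpa using hx))
    exact ⟨F.comp ⟨e.symm, e.symm.continuous⟩, by simpa using h1, fun y => by simpa using h2 y⟩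

lemma isConnected_Lg_of_csr_le {B : Type*} [Ring B] [TopologicalSpace B] {n : ℕ}
    (h : csr B ≤ (n : ℕ∞) + 1) : IsConnected (Lg B (n + 1)) := by
  have hne : {c : ℕ∞ | ∃ n : ℕ, c = n ∧ 1 ≤ n ∧ ∀ m : ℕ, n ≤ m → IsConnected (Lg B m)}.Nonempty := by
    by_contra hcon
    rw [Set.not_nonempty_iff_eq_empty] at hcon
    rw [csr, hcon, sInf_empty, top_le_iff] at h
    exact absurd h (by exact_mod_cast ENat.natCast_ne_top (n + 1))
  obtain ⟨m, hm, -, hc⟩ := csInf_mem hne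
  refine hc _ ?_
  change csr B = m at hm
  rw [hm] at h
  exact_mod_cast h

section GLRel
variable {B : Type*} [NormedRing B]

def GLRel {m : ℕ} (a b : Fin m → B) : Prop :=
  ∃ H K : C(I, Matrix (Fin m) (Fin m) B), (∀ t, H t * K t = 1) ∧ (∀ t, K t * H t = 1) ∧
    H 0 = 1 ∧ (H 1).mulVec a = b

lemma GLRel.symm {m : ℕ} {a b : Fin m → B} (h : GLRel a b) : GLRel b a := by
  obtain ⟨H, K, h1, h2, h3, h4⟩ := h
  refine ⟨K, H, h2, h1, ?_, ?_⟩
  · have := h1 0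
    rwa [h3, one_mul] at this
  · rw [← h4, Matrix.mulVec_mulVec, h2, Matrix.one_mulVec]

lemma GLRel.trans {m : ℕ} {a b c : Fin m → B} (h : GLRel a b) (h' : GLRel b c) : GLRel a c := by
  obtain ⟨H, K, h1, h2, h3, h4⟩ := h
  obtain ⟨H', K', h1', h2', h3', h4'⟩ := h'
  refine ⟨⟨fun t => H' t * H t, by fun_prop⟩, ⟨fun t => K t * K' t, by fun_prop⟩, fun t => ?_,
    fun t => ?_, ?_, ?_⟩
  · show H' t * H t * (K t * K' t) = 1
    rw [mul_assoc, ← mul_assoc (H t), h1, one_mul, h1']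
  · show K t * K' t * (H' t * H t) = 1
    rw [mul_assoc, ← mul_assoc (K' t), h2', one_mul, h2]
  · show H' 0 * H 0 = 1
    rw [h3, h3', one_mul]
  · show (H' 1 * H 1).mulVec a = c
    rw [← Matrix.mulVec_mulVec, h4, h4']

lemma rankOne_mul_inv {R : Type*} [Ring R] {m : ℕ} (c x : Fin m → R) (v : R)
    (h : (1 + x ⬝ᵥ c) * v = 1) :
    (1 + Matrix.vecMulVec c x) * (1 - Matrix.vecMulVec c (fun j => v * x j)) = 1 := by
  have e : Matrix.vecMulVec c x * Matrix.vecMulVec c (fun j => v * x j) =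
      Matrix.vecMulVec c x - Matrix.vecMulVec c (fun j => v * x j) := by
    rw [Matrix.vecMulVec_mul_vecMulVec]
    ext i j
    have : (x ⬝ᵥ c) * v = 1 - v := by
      rw [add_mul, one_mul] at h
      rw [← h]; abel
    simp only [Matrix.vecMulVec_apply, Pi.smul_apply, smul_eq_mul, Matrix.sub_apply]
    rw [← mul_assoc (x ⬝ᵥ c), this]
    noncomm_ring
  rw [mul_sub, mul_one, add_mul, one_mul, e]
  abel

lemma inv_mul_rankOne {R : Type*} [Ring R] {m : ℕ} (c x : Fin m → R) (v : R)
    (h : v * (1 + x ⬝ᵥ c) = 1) :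
    (1 - Matrix.vecMulVec c (fun j => v * x j)) * (1 + Matrix.vecMulVec c x) = 1 := by
  have e : Matrix.vecMulVec c (fun j => v * x j) * Matrix.vecMulVec c x =
      Matrix.vecMulVec c x - Matrix.vecMulVec c (fun j => v * x j) := by
    rw [Matrix.vecMulVec_mul_vecMulVec]
    have h2 : (fun j => v * x j) ⬝ᵥ c = v * (x ⬝ᵥ c) := by
      simp [dotProduct, Finset.mul_sum, mul_assoc]
    ext i j
    have : v * (x ⬝ᵥ c) = 1 - v := by
      rw [mul_add, mul_one] at h
      rw [← h]; abel
    rw [h2, this]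
    simp only [Matrix.vecMulVec_apply, Pi.smul_apply, smul_eq_mul, Matrix.sub_apply]
    noncomm_ring
  rw [mul_add, mul_one, sub_mul, one_mul, e]
  abel

variable [NormedAlgebra ℂ B] [CompleteSpace B]

lemma GLRel_of_norm_lt {m : ℕ} {a b x : Fin m → B} (hx : ∑ i, x i * a i = 1)
    (hb : ‖∑ i, x i * (b i - a i)‖ < 1) : GLRel a b := by
  let c : I → Fin m → B := fun t i => ((t : ℝ) : ℂ) • (b i - a i)
  have hc : Continuous c := by
    refine continuous_pi fun i => ?_
    exact (Complex.continuous_ofReal.comp continuous_subtype_val).smul continuous_const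
  have hxc : ∀ t, x ⬝ᵥ c t = ((t : ℝ) : ℂ) • ∑ i, x i * (b i - a i) := fun t => by
    simp [c, dotProduct, Finset.smul_sum]
  have hu : ∀ t, IsUnit (1 + x ⬝ᵥ c t) := fun t => by
    have : 1 + x ⬝ᵥ c t = 1 - (- (x ⬝ᵥ c t)) := by abel
    rw [this]
    apply isUnit_one_sub_of_norm_lt_one
    rw [norm_neg, hxc, norm_smul]
    refine lt_of_le_of_lt ?_ hb
    refine mul_le_of_le_one_left (norm_nonneg _) ?_
    rw [Complex.norm_real, Real.norm_of_nonneg t.2.1]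
    exact t.2.2
  have hcu : Continuous fun t => 1 + x ⬝ᵥ c t := by
    simp only [hxc]
    exact continuous_const.add
      ((Complex.continuous_ofReal.comp continuous_subtype_val).smul continuous_const)
  let v : I → B := fun t => Ring.inverse (1 + x ⬝ᵥ c t)
  have hv : Continuous v := by
    rw [continuous_iff_continuousAt]
    intro t
    obtain ⟨u, hu⟩ := hu t
    refine ContinuousAt.comp (g := Ring.inverse) (f := fun t => 1 + x ⬝ᵥ c t) ?_ hcu.continuousAt
    rw [← hu]
    exact NormedRing.inverse_continuousAt u
  refine ⟨⟨fun t => 1 + Matrix.vecMulVec (c t) x, ?_⟩,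
    ⟨fun t => 1 - Matrix.vecMulVec (c t) (fun j => v t * x j), ?_⟩, fun t => ?_, fun t => ?_,
    ?_, ?_⟩
  · refine continuous_const.add (continuous_matrix fun i j => ?_)
    exact ((continuous_apply i).comp hc).mul continuous_const
  · refine continuous_const.sub (continuous_matrix fun i j => ?_)
    exact ((continuous_apply i).comp hc).mul (hv.mul continuous_const)
  · exact rankOne_mul_inv _ _ _ (Ring.mul_inverse_cancel _ (hu t))
  · exact inv_mul_rankOne _ _ _ (Ring.inverse_mul_cancel _ (hu t))
  · ext i j
    simp [c, Matrix.vecMulVec_apply]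
  · ext i
    have : ∑ j, (b i - a i) * x j * a j = b i - a i := by
      simp only [mul_assoc]
      rw [← Finset.mul_sum, hx, mul_one]
    have h2 : (Matrix.vecMulVec (c 1) x).mulVec a i = b i - a i := by
      simpa [c, Matrix.mulVec, dotProduct, Matrix.vecMulVec_apply] using this
    show ((1 + Matrix.vecMulVec (c 1) x).mulVec a) i = b i
    rw [Matrix.add_mulVec, Matrix.one_mulVec, Pi.add_apply, h2]
    abel

lemma GLRel_of_isConnected {m : ℕ} (h : IsConnected (Lg B m)) {a b : Fin m → B}
    (ha : a ∈ Lg B m) (hb : b ∈ Lg B m) : GLRel a b := by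
  refine h.isPreconnected.induction₂ GLRel (fun a ha => ?_) (fun _ _ _ _ _ _ h h' => h.trans h')
    (fun _ _ _ _ h => h.symm) ha hb
  obtain ⟨x, hx⟩ := ha
  apply eventually_nhdsWithin_of_eventually_nhds
  have hcont : Continuous fun b : Fin m → B => ‖∑ i, x i * (b i - a i)‖ := by fun_prop
  have := hcont.continuousAt.eventually_lt (continuousAt_const (y := (1 : ℝ))) (x₀ := a) (by simp)
  filter_upwards [this] with b hb
  exact GLRel_of_norm_lt hx hb
end GLRel


lemma continuous_inverse_GLn {A : Type*} [NormedRing A] [CompleteSpace A] (n : ℕ) :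
    Continuous fun g : GLn A n => Ring.inverse g.1 := by
  rw [continuous_iff_continuousAt]
  rintro ⟨g, hg⟩
  obtain ⟨u, rfl⟩ := hg
  have h : ContinuousAt Ring.inverse (u : Matrix (Fin n) (Fin n) A) := by
    let R : NormedRing (Matrix (Fin n) (Fin n) A) := Matrix.linftyOpNormedRing
    have hc : @CompleteSpace _ R.toMetricSpace.toPseudoMetricSpace.toUniformSpace :=
      inferInstanceAs (CompleteSpace (Fin n → Fin n → A))
    exact NormedRing.inverse_continuousAt u
  exact ContinuousAt.comp (f := Subtype.val) (g := Ring.inverse) h continuous_subtype_val.continuousAt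

/-- Evaluation at a point as a ring homomorphism. -/
def evalPointHom (S A : Type*) [TopologicalSpace S] [NormedRing A] (s : S) : C(S, A) →+* A where
  toFun f := f s
  map_one' := rfl
  map_mul' _ _ := rfl
  map_zero' := rfl
  map_add' _ _ := rfl

lemma evalPointHom_apply (S A : Type*) [TopologicalSpace S] [NormedRing A] (s : S) (f : C(S, A)) :
    evalPointHom S A s f = f s := rfl

lemma continuous_evalPoint {S A T : Type*} [TopologicalSpace S] [CompactSpace S] [T2Space S]
    [NormedRing A] [TopologicalSpace T] {m : ℕ} (G : C(T, Matrix (Fin m) (Fin m) C(S, A))) :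
    Continuous fun z : T × S => RingHom.mapMatrix (evalPointHom S A z.2) (G z.1) := by
  refine continuous_matrix fun i j => ?_
  have h : Continuous fun z : T × S => G z.1 i j :=
    ((G.continuous.comp continuous_fst).matrix_elem i j)
  have h2 : Continuous fun z : T × S => (G z.1 i j) z.2 :=
    ContinuousEval.continuous_eval.comp (h.prodMk continuous_snd)
  exact h2

/-- The key geometric lemma: a unimodular column on the cube that is trivial on the boundary
is moved from the last basis vector by a path of invertible matrices. -/
lemma exists_path_of_csr {A : Type*} [NormedRing A] [NormedAlgebra ℂ A] [CompleteSpace A]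
    {k n : ℕ}
    (hcsr : csr C(Metric.sphere (0 : EuclideanSpace ℝ (Fin (k + 1))) 1, A) ≤ (n : ℕ∞) + 1)
    (a x : C(Fin k → I, Fin (n + 1) → A)) (hxa : ∀ y, ∑ i, x y i * a y i = 1)
    (ha : ∀ y ∈ Cube.boundary (Fin k), a y = Pi.single (Fin.last n) 1)
    (hx : ∀ y ∈ Cube.boundary (Fin k), x y = Pi.single (Fin.last n) 1) :
    ∃ H K : C(I × (Fin k → I), Matrix (Fin (n + 1)) (Fin (n + 1)) A),
      (∀ z, H z * K z = 1) ∧ (∀ z, K z * H z = 1) ∧ (∀ y, H (0, y) = 1) ∧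
      (∀ t, ∀ y ∈ Cube.boundary (Fin k), H (t, y) = 1) ∧
      ∀ y, (H (1, y)).mulVec (Pi.single (Fin.last n) 1) = a y := by
  obtain ⟨q, p, hq, hlift⟩ := exists_collapse_sphere k
  let S := Metric.sphere (0 : EuclideanSpace ℝ (Fin (k + 1))) 1
  obtain ⟨F, hFp, hFq⟩ := hlift
    {w : (Fin (n + 1) → A) × (Fin (n + 1) → A) // ∑ i, w.2 i * w.1 i = 1}
    ⟨fun y => ⟨(a y, x y), hxa y⟩, by fun_prop⟩
    ⟨(Pi.single (Fin.last n) 1, Pi.single (Fin.last n) 1), by simp [Pi.single_apply]⟩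
    (fun y hy => by
      apply Subtype.ext
      show (a y, x y) = _
      rw [ha y hy, hx y hy])
  have hFc : Continuous fun s : S => (F s).1 := continuous_subtype_val.comp F.continuous
  let aS : Fin (n + 1) → C(S, A) := fun i => ⟨fun s => (F s).1.1 i,
    (continuous_apply i).comp (continuous_fst.comp hFc)⟩
  let xS : Fin (n + 1) → C(S, A) := fun i => ⟨fun s => (F s).1.2 i,
    (continuous_apply i).comp (continuous_snd.comp hFc)⟩
  have haS : aS ∈ Lg C(S, A) (n + 1) := by
    refine ⟨xS, ?_⟩
    ext s
    simpa [aS, xS, ContinuousMap.sum_apply] using (F s).2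
  have he : (Pi.single (Fin.last n) 1 : Fin (n + 1) → C(S, A)) ∈ Lg C(S, A) (n + 1) :=
    ⟨Pi.single (Fin.last n) 1, by simp [Pi.single_apply]⟩
  obtain ⟨H, K, h1, h2, h3, h4⟩ := GLRel_of_isConnected (isConnected_Lg_of_csr_le hcsr) he haS
  let ev : S → Matrix (Fin (n + 1)) (Fin (n + 1)) C(S, A) →+*
      Matrix (Fin (n + 1)) (Fin (n + 1)) A := fun s =>
    RingHom.mapMatrix (evalPointHom S A s)
  have hev : ∀ (G : C(I, Matrix (Fin (n + 1)) (Fin (n + 1)) C(S, A))),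
      Continuous fun z : I × S => ev z.2 (G z.1) := by
    exact fun G => continuous_evalPoint G
  have hev1 : ∀ s t, ev s (H t) * ev s (K t) = 1 := fun s t => by
    rw [← map_mul, h1, map_one]
  have hev2 : ∀ s t, ev s (K t) * ev s (H t) = 1 := fun s t => by
    rw [← map_mul, h2, map_one]
  have hlast : ∀ s, (ev s (H 1)).mulVec (Pi.single (Fin.last n) 1) = (F s).1.1 := by
    intro s
    ext i
    have := congrArg (fun f : C(S, A) => f s) (congrFun h4 i)
    simpa [ev, evalPointHom_apply, aS, Matrix.mulVec_single_one] using this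
  have hpl : (ev p (K 1)).mulVec (Pi.single (Fin.last n) 1) = Pi.single (Fin.last n) 1 := by
    have h := hlast p
    rw [hFp] at h
    change _ = Pi.single (Fin.last n) 1 at h
    conv_lhs => rw [← h]
    rw [Matrix.mulVec_mulVec, hev2, Matrix.one_mulVec]
  have hK0 : K 0 = 1 := by
    have := h1 0
    rwa [h3, one_mul] at this
  refine ⟨⟨fun z => ev (q z.2) (H z.1) * ev p (K z.1), ?_⟩,
    ⟨fun z => ev p (H z.1) * ev (q z.2) (K z.1), ?_⟩, fun z => ?_, fun z => ?_, fun y => ?_,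
    fun t y hy => ?_, fun y => ?_⟩
  · exact ((hev H).comp (by fun_prop : Continuous fun z : I × (Fin k → I) => (z.1, q z.2))).mul
      ((hev K).comp (by fun_prop : Continuous fun z : I × (Fin k → I) => (z.1, p)))
  · exact ((hev H).comp (by fun_prop : Continuous fun z : I × (Fin k → I) => (z.1, p))).mul
      ((hev K).comp (by fun_prop : Continuous fun z : I × (Fin k → I) => (z.1, q z.2)))
  · show ev (q z.2) (H z.1) * ev p (K z.1) * (ev p (H z.1) * ev (q z.2) (K z.1)) = 1
    rw [mul_assoc, ← mul_assoc (ev p (K z.1)), hev2, one_mul, hev1]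
  · show ev p (H z.1) * ev (q z.2) (K z.1) * (ev (q z.2) (H z.1) * ev p (K z.1)) = 1
    rw [mul_assoc, ← mul_assoc (ev (q z.2) (K z.1)), hev2, one_mul, hev1]
  · show ev (q y) (H 0) * ev p (K 0) = 1
    rw [h3, hK0, map_one, map_one, one_mul]
  · show ev (q y) (H t) * ev p (K t) = 1
    rw [hq y hy, hev1]
  · show (ev (q y) (H 1) * ev p (K 1)).mulVec _ = _
    rw [← Matrix.mulVec_mulVec, hpl, hlast, hFq]
    rfl

section blocks
variable {A : Type*} [Ring A] {n : ℕ}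

lemma diagOneHom_castSucc_castSucc (M : Matrix (Fin n) (Fin n) A) (i j : Fin n) :
    diagOneHom A n M i.castSucc j.castSucc = M i j := by
  simp [diagOneHom]

lemma diagOneHom_castSucc_last (M : Matrix (Fin n) (Fin n) A) (i : Fin n) :
    diagOneHom A n M i.castSucc (Fin.last n) = 0 := by
  simp [diagOneHom]

lemma diagOneHom_last_castSucc (M : Matrix (Fin n) (Fin n) A) (j : Fin n) :
    diagOneHom A n M (Fin.last n) j.castSucc = 0 := by
  simp [diagOneHom]

lemma diagOneHom_last_last (M : Matrix (Fin n) (Fin n) A) :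
    diagOneHom A n M (Fin.last n) (Fin.last n) = 1 := by
  simp [diagOneHom]

def topBlock (M : Matrix (Fin (n + 1)) (Fin (n + 1)) A) : Matrix (Fin n) (Fin n) A :=
  M.submatrix Fin.castSucc Fin.castSucc

lemma topBlock_diagOneHom (M : Matrix (Fin n) (Fin n) A) : topBlock (diagOneHom A n M) = M := by
  ext i j
  exact diagOneHom_castSucc_castSucc M i j

lemma topBlock_mul {M N : Matrix (Fin (n + 1)) (Fin (n + 1)) A}
    (hM : M.mulVec (Pi.single (Fin.last n) 1) = Pi.single (Fin.last n) 1) :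
    topBlock M * topBlock N = topBlock (M * N) := by
  ext i j
  have h : M i.castSucc (Fin.last n) = 0 := by
    have := congrFun hM i.castSucc
    simpa [Matrix.mulVec_single_one] using this
  simp [topBlock, Matrix.mul_apply, Fin.sum_univ_castSucc, h]

lemma topBlock_one : topBlock (1 : Matrix (Fin (n + 1)) (Fin (n + 1)) A) = 1 := by
  rw [← map_one (diagOneHom A n), topBlock_diagOneHom]

lemma isUnit_topBlock {M : Matrix (Fin (n + 1)) (Fin (n + 1)) A} (hu : IsUnit M)
    (hM : M.mulVec (Pi.single (Fin.last n) 1) = Pi.single (Fin.last n) 1) :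
    IsUnit (topBlock M) := by
  obtain ⟨u, rfl⟩ := hu
  have hN : (↑u⁻¹ : Matrix (Fin (n + 1)) (Fin (n + 1)) A).mulVec (Pi.single (Fin.last n) 1)
      = Pi.single (Fin.last n) 1 := by
    conv_lhs => rw [← hM]
    rw [Matrix.mulVec_mulVec, Units.inv_mul, Matrix.one_mulVec]
  exact ⟨⟨topBlock ↑u, topBlock ↑u⁻¹, by rw [topBlock_mul hM, Units.mul_inv, topBlock_one],
    by rw [topBlock_mul hN, Units.inv_mul, topBlock_one]⟩, rfl⟩

lemma isUnit_scale {A : Type*} [Ring A] [Algebra ℂ A]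
    {M : Matrix (Fin (n + 1)) (Fin (n + 1)) A} (hu : IsUnit M)
    (hM : M.mulVec (Pi.single (Fin.last n) 1) = Pi.single (Fin.last n) 1) (s : ℂ) :
    IsUnit (diagOneHom A n (topBlock M) + s • (M - diagOneHom A n (topBlock M))) := by
  have hD := (isUnit_topBlock hu hM).map (diagOneHom A n)
  set D := diagOneHom A n (topBlock M) with hDdef
  set R := M - D with hR
  have r1 : ∀ (i : Fin n) j, R i.castSucc j = 0 := by
    intro i j
    refine Fin.lastCases ?_ (fun j => ?_) j
    · have h : M i.castSucc (Fin.last n) = 0 := by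
        have := congrFun hM i.castSucc
        simpa [Matrix.mulVec_single_one] using this
      simp [hR, hDdef, diagOneHom_castSucc_last, h]
    · simp [hR, hDdef, diagOneHom_castSucc_castSucc, topBlock]
  have r2 : ∀ i, R i (Fin.last n) = 0 := by
    intro i
    refine Fin.lastCases ?_ (fun i => r1 i _) i
    have h : M (Fin.last n) (Fin.last n) = 1 := by
      have := congrFun hM (Fin.last n)
      simpa [Matrix.mulVec_single_one] using this
    simp [hR, hDdef, diagOneHom_last_last, h]
  have hRR : R * R = 0 := by
    ext i j
    simp [Matrix.mul_apply, Fin.sum_univ_castSucc, r1, r2]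
  have hDR : D * R = R := by
    ext i j
    refine Fin.lastCases ?_ (fun i => ?_) i
    · simp [Matrix.mul_apply, Fin.sum_univ_castSucc, r1, hDdef, diagOneHom_last_last]
    · simp [Matrix.mul_apply, Fin.sum_univ_castSucc, r1, hDdef, diagOneHom_castSucc_last]
  have e : D + s • R = D * (1 + s • R) := by
    rw [mul_add, mul_one, mul_smul_comm, hDR]
  rw [e]
  refine hD.mul ⟨⟨1 + s • R, 1 - s • R, ?_, ?_⟩, rfl⟩
  · rw [mul_sub, mul_one, add_mul, one_mul, smul_mul_smul_comm, hRR]; simp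
  · rw [mul_add, mul_one, sub_mul, one_mul, smul_mul_smul_comm, hRR]; simp

lemma continuous_topBlock [TopologicalSpace A] :
    Continuous (topBlock : Matrix (Fin (n + 1)) (Fin (n + 1)) A → _) :=
  continuous_id.matrix_submatrix _ _

lemma diagOneHom_mulVec_last (M : Matrix (Fin n) (Fin n) A) :
    (diagOneHom A n M).mulVec (Pi.single (Fin.last n) 1) = Pi.single (Fin.last n) 1 := by
  ext i
  refine Fin.lastCases ?_ (fun i => ?_) i
  · simp [diagOneHom_last_last]
  · simp [diagOneHom_castSucc_last]

lemma diagOneHom_last_row (M : Matrix (Fin n) (Fin n) A) :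
    diagOneHom A n M (Fin.last n) = Pi.single (Fin.last n) 1 := by
  ext i
  refine Fin.lastCases ?_ (fun i => ?_) i
  · simp [diagOneHom_last_last]
  · simp [diagOneHom_last_castSucc]

end blocks

/-- Column clearing: a map of the cube into `GL_{n+1}(A)` whose boundary values lie in `GL_n(A)`
can be multiplied by a path of invertible matrices to fix the last basis vector. -/
lemma exists_clearing {A : Type*} [NormedRing A] [NormedAlgebra ℂ A] [CompleteSpace A]
    {k n : ℕ}
    (hcsr : csr C(Metric.sphere (0 : EuclideanSpace ℝ (Fin (k + 1))) 1, A) ≤ (n : ℕ∞) + 1)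
    (f : C(Fin k → I, GLn A (n + 1)))
    (hf : ∀ y ∈ Cube.boundary (Fin k), ∃ g : GLn A n, f y = glSucc A n g) :
    ∃ K : C(I × (Fin k → I), Matrix (Fin (n + 1)) (Fin (n + 1)) A),
      (∀ z, IsUnit (K z)) ∧ (∀ y, K (0, y) = 1) ∧
      (∀ t, ∀ y ∈ Cube.boundary (Fin k), K (t, y) = 1) ∧
      ∀ y, (K (1, y) * (f y).1).mulVec (Pi.single (Fin.last n) 1) = Pi.single (Fin.last n) 1 := by
  have hinv : Continuous fun y => Ring.inverse (f y).1 :=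
    (continuous_inverse_GLn (n + 1)).comp f.continuous
  have hval : Continuous fun y => (f y).1 := continuous_subtype_val.comp f.continuous
  obtain ⟨H, K, h1, h2, h3, h4, h5⟩ := exists_path_of_csr hcsr
    ⟨fun y => (f y).1.mulVec (Pi.single (Fin.last n) 1),
      hval.matrix_mulVec continuous_const⟩
    ⟨fun y => Ring.inverse (f y).1 (Fin.last n),
      (continuous_apply (Fin.last n)).comp hinv⟩
    (fun y => by
      have := congrArg (fun M : Matrix (Fin (n + 1)) (Fin (n + 1)) A =>
        M (Fin.last n) (Fin.last n)) (Ring.inverse_mul_cancel _ (f y).2)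
      show ∑ i, Ring.inverse (f y).1 (Fin.last n) i *
        ((f y).1.mulVec (Pi.single (Fin.last n) 1)) i = 1
      simpa [Matrix.mul_apply, Matrix.mulVec_single_one] using this)
    (fun y hy => by
      obtain ⟨g, hg⟩ := hf y hy
      show (f y).1.mulVec _ = _
      rw [hg]
      exact diagOneHom_mulVec_last _)
    (fun y hy => by
      obtain ⟨g, hg⟩ := hf y hy
      show Ring.inverse (f y).1 _ = _
      have : Ring.inverse (f y).1 = diagOneHom A n (Ring.inverse g.1) := by
        have e1 : (f y).1 * diagOneHom A n (Ring.inverse g.1) = 1 := by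
          rw [hg]
          show diagOneHom A n g.1 * _ = 1
          rw [← map_mul, Ring.mul_inverse_cancel _ g.2, map_one]
        calc Ring.inverse (f y).1 = Ring.inverse (f y).1 *
              ((f y).1 * diagOneHom A n (Ring.inverse g.1)) := by rw [e1, mul_one]
          _ = _ := by rw [← mul_assoc, Ring.inverse_mul_cancel _ (f y).2, one_mul]
      rw [this]
      exact diagOneHom_last_row _)
  have hK : ∀ z, H z = 1 → K z = 1 := fun z hz => by
    have := h1 z
    rwa [hz, one_mul] at this
  refine ⟨K, fun z => ⟨⟨K z, H z, h2 z, h1 z⟩, rfl⟩, fun y => hK _ (h3 y),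
    fun t y hy => hK _ (h4 t y hy), fun y => ?_⟩
  rw [← Matrix.mulVec_mulVec]
  have := h5 y
  change _ = (f y).1.mulVec _ at this
  rw [← this, Matrix.mulVec_mulVec, h2, Matrix.one_mulVec]

lemma pik_surjective {A : Type*} [NormedRing A] [NormedAlgebra ℂ A] [CompleteSpace A] {k n : ℕ}
    (hcsr : csr C(Metric.sphere (0 : EuclideanSpace ℝ (Fin (k + 1))) 1, A) ≤ (n : ℕ∞) + 1) :
    Function.Surjective (piMap (Fin k)
          (⟨glSucc A n, continuous_glSucc A n⟩ : C(GLn A n, GLn A (n + 1)))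
          (glSucc_one A n)) := by
  intro c
  induction c using Quotient.inductionOn with | _ f
  obtain ⟨K, hu, hK0, hKb, hK1⟩ := exists_clearing hcsr f.1
    (fun y hy => ⟨⟨1, isUnit_one⟩, by rw [glSucc_one]; exact f.2 y hy⟩)
  have hval : Continuous fun y => (f.1 y).1 := continuous_subtype_val.comp f.1.continuous
  have hfb : ∀ y ∈ Cube.boundary (Fin k), (f.1 y).1 = 1 := fun y hy => by
    rw [f.2 y hy]
  have hg1u : ∀ y, IsUnit (K (1, y) * (f.1 y).1) := fun y => (hu _).mul (f.1 y).2
  have hg1c : Continuous fun y => K (1, y) * (f.1 y).1 := by fun_prop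
  let g1 : C(Fin k → I, GLn A (n + 1)) :=
    ⟨fun y => ⟨K (1, y) * (f.1 y).1, hg1u y⟩, hg1c.subtype_mk _⟩
  have hcb : Continuous fun y => topBlock (K (1, y) * (f.1 y).1) :=
    continuous_topBlock.comp hg1c
  let gS : GenLoop (Fin k) (GLn A n) ⟨1, isUnit_one⟩ :=
    ⟨⟨fun y => ⟨topBlock (K (1, y) * (f.1 y).1), isUnit_topBlock (hg1u y) (hK1 y)⟩,
      hcb.subtype_mk _⟩, fun y hy => by
        apply Subtype.ext
        show topBlock (K (1, y) * (f.1 y).1) = 1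
        rw [hKb 1 y hy, hfb y hy, mul_one, topBlock_one]⟩
  refine ⟨Quotient.mk _ gS, Quotient.sound ?_⟩
  have hom1 : ContinuousMap.HomotopicRel f.1 g1 (Cube.boundary (Fin k)) := by
    refine ⟨⟨⟨⟨fun z => ⟨K z * (f.1 z.2).1, (hu _).mul (f.1 z.2).2⟩, ?_⟩, fun y => ?_, fun y => ?_⟩,
      fun t y hy => ?_⟩⟩
    · exact Continuous.subtype_mk (by fun_prop) _
    · apply Subtype.ext
      show K (0, y) * (f.1 y).1 = (f.1 y).1
      rw [hK0, one_mul]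
    · rfl
    · apply Subtype.ext
      show K (t, y) * (f.1 y).1 = (f.1 y).1
      rw [hKb t y hy, one_mul]
  have hdc : Continuous fun y => diagOneHom A n (topBlock (K (1, y) * (f.1 y).1)) :=
    (continuous_diagOneHom A n).comp hcb
  have hom2 : ContinuousMap.HomotopicRel
      ((⟨glSucc A n, continuous_glSucc A n⟩ : C(GLn A n, GLn A (n + 1))).comp gS.1) g1
      (Cube.boundary (Fin k)) := by
    refine ⟨⟨⟨⟨fun z => ⟨_, isUnit_scale (hg1u z.2) (hK1 z.2) ((z.1 : ℝ) : ℂ)⟩, ?_⟩,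
      fun y => ?_, fun y => ?_⟩, fun t y hy => ?_⟩⟩
    · refine Continuous.subtype_mk ?_ _
      have c1 : Continuous fun z : I × (Fin k → I) => ((z.1 : ℝ) : ℂ) :=
        Complex.continuous_ofReal.comp (continuous_subtype_val.comp continuous_fst)
      have c2 := hdc.comp (continuous_snd (X := I))
      have c3 := hg1c.comp (continuous_snd (X := I))
      exact c2.add (c1.smul (c3.sub c2))
    · apply Subtype.ext
      show _ + (((0 : I) : ℝ) : ℂ) • _ = diagOneHom A n (topBlock (K (1, y) * (f.1 y).1))
      simp
    · apply Subtype.ext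
      show _ + (((1 : I) : ℝ) : ℂ) • _ = K (1, y) * (f.1 y).1
      simp
    · apply Subtype.ext
      show diagOneHom A n (topBlock (K (1, y) * (f.1 y).1)) + _ • (K (1, y) * (f.1 y).1 -
        diagOneHom A n (topBlock (K (1, y) * (f.1 y).1))) =
          diagOneHom A n (topBlock (K (1, y) * (f.1 y).1))
      rw [hKb 1 y hy, hfb y hy, mul_one, topBlock_one, map_one, sub_self, smul_zero, add_zero]
  exact hom2.trans hom1.symm

lemma pik_injective {A : Type*} [NormedRing A] [NormedAlgebra ℂ A] [CompleteSpace A] {k n : ℕ}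
    (hcsr : csr C(Metric.sphere (0 : EuclideanSpace ℝ (Fin (k + 2))) 1, A) ≤ (n : ℕ∞) + 1) :
    Function.Injective (piMap (Fin k)
          (⟨glSucc A n, continuous_glSucc A n⟩ : C(GLn A n, GLn A (n + 1)))
          (glSucc_one A n)) := by
  intro c d hcd
  induction c using Quotient.inductionOn with | _ f
  induction d using Quotient.inductionOn with | _ g
  obtain ⟨F⟩ : ContinuousMap.HomotopicRel
      ((⟨glSucc A n, continuous_glSucc A n⟩ : C(GLn A n, GLn A (n + 1))).comp f.1)
      ((⟨glSucc A n, continuous_glSucc A n⟩ : C(GLn A n, GLn A (n + 1))).comp g.1)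
      (Cube.boundary (Fin k)) := Quotient.exact hcd
  have hF0 : ∀ y, F (0, y) = glSucc A n (f.1 y) := fun y => F.apply_zero y
  have hF1 : ∀ y, F (1, y) = glSucc A n (g.1 y) := fun y => F.apply_one y
  have hFb : ∀ t, ∀ y ∈ Cube.boundary (Fin k), F (t, y) = glSucc A n (f.1 y) :=
    fun t y hy => F.eq_fst t hy
  let E : C(Fin (k + 1) → I, GLn A (n + 1)) :=
    ⟨fun y => F (y 0, fun i => y i.succ), by fun_prop⟩
  have hEb : ∀ y ∈ Cube.boundary (Fin (k + 1)), ∃ g : GLn A n, E y = glSucc A n g := by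
    rintro y ⟨i, hi⟩
    induction i using Fin.cases with
    | zero =>
      rcases hi with hi | hi
      · exact ⟨_, by show F (y 0, _) = _; rw [hi]; exact hF0 _⟩
      · exact ⟨_, by show F (y 0, _) = _; rw [hi]; exact hF1 _⟩
    | succ i => exact ⟨_, hFb _ _ ⟨i, hi⟩⟩
  obtain ⟨K, hu, -, hKb, hK1⟩ := exists_clearing hcsr E hEb
  let cons : I × (Fin k → I) → (Fin (k + 1) → I) := fun z => Fin.cons z.1 z.2
  have hcons : Continuous cons := by
    refine continuous_pi fun i => ?_
    induction i using Fin.cases with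
    | zero => simpa [cons] using continuous_fst
    | succ i => exact (continuous_apply i).comp continuous_snd
  have hEc : ∀ z, E (cons z) = F z := fun z => by simp [E, cons]
  have hEu : ∀ y, IsUnit (K (1, y) * (E y).1) := fun y => (hu _).mul (E y).2
  have hEcont : Continuous fun y => K (1, y) * (E y).1 := by fun_prop
  have key : ∀ z (w : GLn A n), cons z ∈ Cube.boundary (Fin (k + 1)) → F z = glSucc A n w →
      topBlock (K (1, cons z) * (E (cons z)).1) = w.1 := by
    intro z w hz hw
    rw [hKb 1 _ hz, one_mul, hEc, hw]
    exact topBlock_diagOneHom _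
  refine Quotient.sound ?_
  refine ⟨⟨⟨⟨fun z => ⟨topBlock (K (1, cons z) * (E (cons z)).1),
    isUnit_topBlock (hEu _) (hK1 _)⟩, ?_⟩, fun y => ?_, fun y => ?_⟩, fun t y hy => ?_⟩⟩
  · exact Continuous.subtype_mk (continuous_topBlock.comp (hEcont.comp hcons)) _
  · exact Subtype.ext (key (0, y) _ ⟨0, Or.inl rfl⟩ (hF0 y))
  · exact Subtype.ext (key (1, y) _ ⟨0, Or.inr rfl⟩ (hF1 y))
  · obtain ⟨i, hi⟩ := hy
    exact Subtype.ext (key (t, y) _ ⟨i.succ, hi⟩ (hFb t y ⟨i, hi⟩))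

end Helpers

/-- For a unital complex Banach algebra `A` and `k ≥ 0`, the map
`π_k(GL_n(A)) → π_k(GL_{n+1}(A))` induced by `g ↦ diag(g, 1)` (based at the identity) is
surjective for every `n ≥ csr A(Sᵏ) − 1` and injective for every `n ≥ csr A(Sᵏ⁺¹) − 1`,
where `A(Sᵏ) = C(Sᵏ, A)`. -/
theorem pik_stabilization_csr_spheres (A : Type*)
    [NormedRing A] [NormedAlgebra ℂ A] [CompleteSpace A] (k : ℕ) :
    ∀ n : ℕ,
      (csr C(Metric.sphere (0 : EuclideanSpace ℝ (Fin (k + 1))) 1, A) ≤ (n : ℕ∞) + 1 →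
        Function.Surjective (piMap (Fin k)
          (⟨glSucc A n, continuous_glSucc A n⟩ : C(GLn A n, GLn A (n + 1)))
          (glSucc_one A n))) ∧
      (csr C(Metric.sphere (0 : EuclideanSpace ℝ (Fin (k + 2))) 1, A) ≤ (n : ℕ∞) + 1 →
        Function.Injective (piMap (Fin k)
          (⟨glSucc A n, continuous_glSucc A n⟩ : C(GLn A n, GLn A (n + 1)))
          (glSucc_one A n))) := by
  exact fun n => ⟨fun h => pik_surjective h, fun h => pik_injective h⟩
end
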